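/- Fix an integer r ≥ 3 and let {T_n^{(r)}} be the generalized r-tribonacci numbers. For every integer n ≥ 3, the Toeplitz–Hessenberg determinant det(1; T_r^{(r)}, T_{r+1}^{(r)}, …, T_{n+r−1}^{(r)}) equals (−1)^{n−1} δ_{n,r}, where δ_{n,r} is the Kronecker delta (equal to 1 if n = r and 0 otherwise). -/

import Mathlib

/-- The determinant of the `n × n` Toeplitz–Hessenberg matrix whose `(i,j)` entry
(0-indexed) is `a (i - j + 1)` when `j ≤ i + 1` (so `a 0` lies on the superdiagonal
and `a k` on the `k`-th subdiagonal) and `0` otherwise. -/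
def THdet (a : ℕ → ℤ) (n : ℕ) : ℤ :=
  (Matrix.of fun i j : Fin n => if (j : ℕ) ≤ (i : ℕ) + 1 then a ((i : ℕ) + 1 - (j : ℕ)) else 0).det

/-- If `a` and `c` are inverse to each other under Cauchy convolution and `a 0 = 1`, the
Toeplitz–Hessenberg determinants of `a` are, up to sign, the terms of `c`. -/
theorem THdet_succ_of_convolution_inverse (a c : ℕ → ℤ) (ha : a 0 = 1)
    (hac : ∀ n, ∑ k ∈ Finset.range (n + 1), c k * a (n - k) = if n = 0 then 1 else 0) (m : ℕ) :
    THdet a (m + 1) = (-1) ^ (m + 1) * c (m + 1) := by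
  have hc : c 0 = 1 := by simpa [ha] using hac 0
  set A : Matrix (Fin (m + 1)) (Fin (m + 1)) ℤ := Matrix.of fun i j =>
    if (j : ℕ) ≤ (i : ℕ) + 1 then a ((i : ℕ) + 1 - (j : ℕ)) else 0 with hA
  let L : Matrix (Fin (m + 1)) (Fin (m + 1)) ℤ := Matrix.of fun i j =>
    if (j : ℕ) ≤ (i : ℕ) then c ((i : ℕ) - (j : ℕ)) else 0
  have hL : L.det = 1 := by
    rw [Matrix.det_of_isLowerTriangular]
    · simp [L, hc]
    · intro i j hij
      have : ¬ j ≤ i := not_le.mpr hij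
      simp [L, this]
  have hsum (i j : Fin (m + 1)) : (L * A) i j =
      ∑ k ∈ Finset.range (i + 1), c k * (if (j : ℕ) ≤ i - k + 1 then a (i - k + 1 - j) else 0) := by
    rw [Matrix.mul_apply, ← Finset.sum_range_reflect]
    simp only [L, hA, Matrix.of_apply]
    rw [Fin.sum_univ_eq_sum_range (fun k => (if k ≤ (i : ℕ) then c (i - k) else 0) *
      (if (j : ℕ) ≤ k + 1 then a (k + 1 - j) else 0)) (m + 1)]
    symm
    apply Finset.sum_subset_zero_on_sdiff
    · intro k
      simp only [Finset.mem_range]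
      omega
    · intro k hk
      simp only [Finset.mem_sdiff, Finset.mem_range] at hk
      rw [if_neg (by omega), zero_mul]
    · intro k hk
      simp only [Finset.mem_range] at hk
      rw [if_pos (show k ≤ (i : ℕ) by omega), show (i : ℕ) + 1 - 1 - k = i - k by omega,
        show (i : ℕ) - (i - k) = k by omega]
  have hzero (i : Fin (m + 1)) : (L * A) i 0 = -c (i + 1) := by
    have h := hac (i + 1)
    rw [Finset.sum_range_succ, Nat.sub_self, ha, if_neg (by omega)] at h
    rw [hsum, eq_neg_iff_add_eq_zero, ← h, mul_one]
    congr 1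
    refine Finset.sum_congr rfl fun k hk => ?_
    simp only [Finset.mem_range] at hk
    rw [if_pos (by simp), Fin.val_zero, Nat.sub_zero, show (i : ℕ) + 1 - k = i - k + 1 by omega]
  have hsucc (i : Fin (m + 1)) (j : Fin m) :
      (L * A) i j.succ = if (i : ℕ) = j then 1 else 0 := by
    rw [hsum, Fin.val_succ]
    by_cases hij : (j : ℕ) ≤ i
    · have h := hac (i - j)
      simp only [show (i : ℕ) - j = 0 ↔ (i : ℕ) = j by omega] at h
      rw [← h]
      symm
      apply Finset.sum_subset_zero_on_sdiff
      · intro k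
        simp only [Finset.mem_range]
        omega
      · intro k hk
        simp only [Finset.mem_sdiff, Finset.mem_range] at hk
        rw [if_neg (by omega), mul_zero]
      · intro k hk
        simp only [Finset.mem_range] at hk
        rw [if_pos (by omega), show (i : ℕ) - k + 1 - (j + 1) = i - j - k by omega]
    · rw [if_neg (by omega)]
      refine Finset.sum_eq_zero fun k _ => ?_
      rw [if_neg (by omega), mul_zero]
  have hdet : (L * A).det = (-1) ^ m * -c (m + 1) := by
    rw [Matrix.det_succ_row _ (Fin.last m), Fin.sum_univ_succ, Finset.sum_eq_zero, add_zero]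
    · have : (L * A).submatrix (Fin.last m).succAbove (Fin.succAbove 0) = 1 := by
        ext i j
        simp [hsucc, Matrix.one_apply, Fin.ext_iff]
      rw [this, hzero]
      simp
    · intro j _
      rw [hsucc, if_neg (by simp; omega)]
      simp
  rw [Matrix.det_mul, hL, one_mul] at hdet
  rw [THdet, ← hA, hdet]
  ring

/-- The reciprocal of the generating function of `T (k + r - 1)` is `1 - x - x ^ 2 - x ^ r`. -/
theorem tribonacci_convolution (r : ℕ) (hr : 3 ≤ r) (T : ℕ → ℤ)
    (hT0 : ∀ k, k < r - 1 → T k = 0) (hT1 : T (r - 1) = 1)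
    (hTrec : ∀ n, r ≤ n → T n = T (n - 1) + T (n - 2) + T (n - r)) (n : ℕ) :
    ∑ k ∈ Finset.range (n + 1), ((if k = 0 then 1 else 0) - (if k = 1 then 1 else 0) -
      (if k = 2 then 1 else 0) - (if k = r then 1 else 0)) * T (n - k + r - 1) =
      if n = 0 then 1 else 0 := by
  simp only [sub_mul, ite_mul, one_mul, zero_mul, Finset.sum_sub_distrib, Finset.sum_ite_eq',
    Finset.mem_range]
  rcases Nat.eq_zero_or_pos n with rfl | hn
  · simp [hT1, show r ≠ 0 by omega]
  have h := hTrec (n + r - 1) (by omega)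
  rw [show n + r - 1 - 1 = n - 1 + r - 1 by omega, show n + r - 1 - r = n - 1 by omega] at h
  have h₂ : (if 2 < n + 1 then T (n - 2 + r - 1) else 0) = T (n + r - 1 - 2) := by
    split_ifs with h₂
    · congr 1
      omega
    · exact (hT0 _ (by omega)).symm
  have h₃ : (if r < n + 1 then T (n - r + r - 1) else 0) = T (n - 1) := by
    split_ifs with h₃
    · congr 1
      omega
    · exact (hT0 _ (by omega)).symm
  rw [h₂, h₃, if_pos (by omega), if_pos (by omega), if_neg (by omega), Nat.sub_zero, h]
  ring

theorem stmt_16 (r : ℕ) (hr : 3 ≤ r) (T : ℕ → ℤ)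
    (hT0 : ∀ k, k < r - 1 → T k = 0) (hT1 : T (r - 1) = 1)
    (hTrec : ∀ n, r ≤ n → T n = T (n - 1) + T (n - 2) + T (n - r))
    (n : ℕ) (hn : 3 ≤ n) :
    THdet (fun k => if k = 0 then 1 else T (k + r - 1)) n =
      (-1) ^ (n - 1) * (if n = r then 1 else 0) := by
  have hfun : (fun k => if k = 0 then 1 else T (k + r - 1)) = fun k => T (k + r - 1) := by
    funext k
    split_ifs with hk
    · simp [hk, hT1]
    · rfl
  obtain ⟨m, rfl⟩ := Nat.exists_eq_add_of_le' (show 1 ≤ n by omega)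
  rw [hfun, THdet_succ_of_convolution_inverse _ _ (by simpa using hT1)
    (tribonacci_convolution r hr T hT0 hT1 hTrec), if_neg (by omega), if_neg (by omega),
    if_neg (by omega), Nat.add_sub_cancel]
  ring
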